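/- Let Σ = {a,b}, let n ≥ 2, and let w ∈ {a^{n-1}b, ab^{n-1}, ba^{n-1}, b^{n-1}a}. Then the syntactic complexity of L = Σ* w Σ* equals n², i.e., σ(L) = n². -/

import Mathlib

/-- The two-letter alphabet Σ = {a, b}. -/
inductive Letter : Type
  | a : Letter
  | b : Letter
deriving DecidableEq

/-- The syntactic (Myhill) congruence of a language L, as a setoid on Σ⁺. -/
def synSetoid (L : Set (List Letter)) : Setoid {u : List Letter // u ≠ []} where
  r u v := ∀ x y : List Letter, x ++ u.val ++ y ∈ L ↔ x ++ v.val ++ y ∈ L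
  iseqv := ⟨fun _ _ _ => Iff.rfl, fun h x y => (h x y).symm,
    fun h1 h2 x y => (h1 x y).trans (h2 x y)⟩

/-- The syntactic complexity of L: the cardinality of its syntactic semigroup Σ⁺/≈_L. -/
noncomputable def syntacticComplexity (L : Set (List Letter)) : ℕ :=
  Nat.card (Quotient (synSetoid L))

/-- The language Σ* w Σ* of all words containing w as a factor. -/
def factorLang (w : List Letter) : Set (List Letter) := {u : List Letter | w <:+: u}

/-- The set of inner factors of w: nonempty words u with w = t u s for nonempty t, s. -/
def innerFactors (w : List Letter) : Set (List Letter) :=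
  {u : List Letter | u ≠ [] ∧ ∃ t s : List Letter, t ≠ [] ∧ s ≠ [] ∧ w = t ++ u ++ s}

/-- One step of the automaton recognising words containing `p^m q`. -/
def stp (m : ℕ) (p : Letter) (s : ℕ) (c : Letter) : ℕ :=
  if s = m + 1 then m + 1 else
  if c = p then (if s = m then m else s + 1) else (if s = m then m + 1 else 0)

/-- Run of the automaton. -/
def rn (m : ℕ) (p : Letter) (s : ℕ) (u : List Letter) : ℕ := u.foldl (stp m p) s

/-- The transformation with code `(i, j)`. -/
def FF (m i j s : ℕ) : ℕ :=
  if i < m then (if m ≤ s + i then m + 1 else j)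
  else if j = 0 then m + 1 else if m ≤ s + j then m else s + j

/-- Representative word of the code `(i, j)`. -/
def rp (m : ℕ) (p q : Letter) (i j : ℕ) : List Letter :=
  if i < m then List.replicate i p ++ q :: List.replicate j p
  else if j = 0 then List.replicate m p ++ [q] else List.replicate j p

theorem rn_append (m : ℕ) (p : Letter) (s : ℕ) (u v : List Letter) :
    rn m p s (u ++ v) = rn m p (rn m p s u) v := by
  simp [rn, List.foldl_append]

theorem stp_le (m : ℕ) (p : Letter) (s : ℕ) (c : Letter) (h : s ≤ m + 1) :
    stp m p s c ≤ m + 1 := by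
  unfold stp; split_ifs <;> omega

theorem rn_le (m : ℕ) (p : Letter) (u : List Letter) : ∀ s, s ≤ m + 1 →
    rn m p s u ≤ m + 1 := by
  induction u with
  | nil => intro s h; simpa [rn] using h
  | cons c u ih => intro s h; exact ih _ (stp_le m p s c h)

theorem rn_top (m : ℕ) (p : Letter) (u : List Letter) : rn m p (m + 1) u = m + 1 := by
  induction u with
  | nil => simp [rn]
  | cons c u ih =>
    have : stp m p (m+1) c = m + 1 := by simp [stp]
    simpa [rn, this] using ih

theorem rn_rep (m : ℕ) (p : Letter) (k : ℕ) : ∀ s, s ≤ m →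
    rn m p s (List.replicate k p) = if m ≤ s + k then m else s + k := by
  induction k with
  | zero => intro s h; simp [rn]; omega
  | succ k ih =>
    intro s h
    have h1 : rn m p s (List.replicate (k+1) p) = rn m p (stp m p s p) (List.replicate k p) := rfl
    have h2 : stp m p s p = if s = m then m else s + 1 := by
      simp [stp]; omega
    rw [h1, h2]
    split_ifs with h3 h4 h4
    · rw [ih _ le_rfl]; simp
    · omega
    · rw [ih _ (by omega)]; split_ifs <;> omega
    · rw [ih _ (by omega)]; split_ifs <;> omega

theorem rn_cons (m : ℕ) (p : Letter) (s : ℕ) (c : Letter) (u : List Letter) :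
    rn m p s (c :: u) = rn m p (stp m p s c) u := rfl

theorem skip (m : ℕ) (p q : Letter) (hpq : q ≠ p) (u : List Letter) : ∀ s, s < m →
    (List.replicate m p ++ [q] <:+: List.replicate s p ++ q :: u ↔
      List.replicate m p ++ [q] <:+: u) := by
  have key : ∀ s m : ℕ, s < m →
      ¬ (List.replicate m p ++ [q] <+: List.replicate s p ++ q :: u) := by
    intro s
    induction s with
    | zero =>
      intro m hm
      obtain ⟨m, rfl⟩ : ∃ k, m = k + 1 := ⟨m - 1, by omega⟩
      simp [List.replicate_succ, List.cons_prefix_cons, hpq.symm]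
    | succ s ih =>
      intro m hm
      obtain ⟨m, rfl⟩ : ∃ k, m = k + 1 := ⟨m - 1, by omega⟩
      simpa [List.replicate_succ, List.cons_prefix_cons] using ih m (by omega)
  intro s
  induction s with
  | zero =>
    intro h
    have := key 0 m h
    simp only [List.replicate_zero, List.nil_append] at this ⊢
    rw [List.infix_cons_iff]; tauto
  | succ s ih =>
    intro h
    have h1 := key (s+1) m h
    have h2 := ih (by omega)
    simp only [List.replicate_succ, List.cons_append] at h1 ⊢
    rw [List.infix_cons_iff, h2]; tauto

theorem rn_mem (m : ℕ) (p q : Letter) (hpq : q ≠ p) (hc : ∀ c, c ≠ p → c = q)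
    (u : List Letter) : ∀ s, s ≤ m →
    (rn m p s u = m + 1 ↔ List.replicate m p ++ [q] <:+: List.replicate s p ++ u) := by
  induction u with
  | nil =>
    intro s h
    constructor
    · intro h'; simp [rn] at h'; omega
    · intro h'
      have := h'.length_le
      simp at this; omega
  | cons c u ih =>
    intro s h
    rw [rn_cons]
    by_cases hcp : c = p
    · subst hcp
      have e : List.replicate s c ++ c :: u = List.replicate (s+1) c ++ u := by
        rw [List.replicate_succ']; simp
      rw [e]
      by_cases hs : s = m
      · subst hs
        have h2 : stp s c s c = s := by simp [stp]
        rw [h2, ih s le_rfl]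
        rw [List.replicate_succ, List.cons_append, List.infix_cons_iff]
        have : ¬ (List.replicate s c ++ [q] <+: c :: (List.replicate s c ++ u)) := by
          rw [← List.cons_append, ← List.replicate_succ, ← e, List.prefix_append_right_inj]
          simp [List.cons_prefix_cons, hpq]
        tauto
      · have h2 : stp m c s c = s + 1 := by simp [stp, hs]; omega
        rw [h2, ih _ (by omega)]
    · obtain rfl := hc c hcp
      by_cases hs : s = m
      · subst hs
        have h2 : stp s p s c = s + 1 := by simp [stp, hpq]
        rw [h2, rn_top]
        refine ⟨fun _ => ⟨[], u, by simp⟩, fun _ => rfl⟩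
      · have h2 : stp m p s c = 0 := by simp [stp, hs, hpq]; omega
        rw [h2, ih 0 (by omega), skip m p c hpq u s (by omega)]
        simp

theorem mem_iff (m : ℕ) (p q : Letter) (hpq : q ≠ p) (hc : ∀ c, c ≠ p → c = q)
    (u : List Letter) :
    u ∈ factorLang (List.replicate m p ++ [q]) ↔ rn m p 0 u = m + 1 := by
  rw [rn_mem m p q hpq hc u 0 (by omega)]; simp [factorLang]

theorem equiv_iff (m : ℕ) (p q : Letter) (hpq : q ≠ p) (hc : ∀ c, c ≠ p → c = q)
    (u v : {u : List Letter // u ≠ []}) :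
    (synSetoid (factorLang (List.replicate m p ++ [q]))).r u v ↔
      ∀ s, s ≤ m → rn m p s u.1 = rn m p s v.1 := by
  constructor
  · intro h s hs
    have h0 : rn m p 0 (List.replicate s p) = s := by
      rw [rn_rep m p s 0 (by omega)]; split_ifs <;> omega
    have h1 : ∀ y, rn m p (rn m p s u.1) y = m + 1 ↔ rn m p (rn m p s v.1) y = m + 1 := by
      intro y
      have := h (List.replicate s p) y
      rw [mem_iff m p q hpq hc, mem_iff m p q hpq hc] at this
      simpa only [rn_append, h0] using this
    have hu := rn_le m p u.1 s (by omega)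
    have hv := rn_le m p v.1 s (by omega)
    generalize rn m p s u.1 = x at *
    generalize rn m p s v.1 = z at *
    have acc : ∀ t, t ≤ m → ∀ k, rn m p t (List.replicate k p ++ [q]) = m + 1 ↔ m ≤ t + k := by
      intro t ht k
      rw [rn_append, rn_rep m p k t ht]
      split_ifs with h
      · simp [rn, stp, hpq, h]
      · simp [rn, stp, hpq, h]; omega
    have e := h1 []
    simp only [rn, List.foldl_nil] at e
    by_cases hx : x = m + 1
    · rw [hx, e.1 hx]
    · have hz : z ≠ m + 1 := fun h => hx (e.2 h)
      have a1 := h1 (List.replicate (m - x) p ++ [q])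
      have a2 := h1 (List.replicate (m - z) p ++ [q])
      rw [acc x (by omega), acc z (by omega)] at a1 a2
      omega
  · intro h x y
    rw [mem_iff m p q hpq hc, mem_iff m p q hpq hc]
    simp only [rn_append]
    have hx := rn_le m p x 0 (by omega)
    by_cases hx' : rn m p 0 x = m + 1
    · simp [hx', rn_top]
    · rw [h _ (by omega)]

theorem rn_rp (m : ℕ) (p q : Letter) (hpq : q ≠ p) (i j s : ℕ) (hj : j ≤ m)
    (hs : s ≤ m) : rn m p s (rp m p q i j) = FF m i j s := by
  unfold rp FF
  split_ifs with h1 h2 h2 h3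
  · rw [rn_append, rn_rep m p i s hs, if_pos h2, rn_cons]
    have : stp m p m q = m + 1 := by simp [stp, hpq]
    rw [this, rn_top]
  · rw [rn_append, rn_rep m p i s hs, if_neg h2, rn_cons]
    have : stp m p (s + i) q = 0 := by
      unfold stp; rw [if_neg (by omega), if_neg hpq, if_neg (by omega)]
    rw [this, rn_rep m p j 0 (by omega)]; split_ifs <;> omega
  · rw [rn_append, rn_rep m p m s hs, if_pos (by omega)]
    simp [rn, stp, hpq]
  · rw [rn_rep m p j s hs, if_pos h3]
  · rw [rn_rep m p j s hs, if_neg h3]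

theorem FF_step (m : ℕ) (hm : 1 ≤ m) (p : Letter) (c : Letter) (i j : ℕ) (hi : i ≤ m)
    (hj : j ≤ m) : ∃ i' j', i' ≤ m ∧ j' ≤ m ∧ ∀ s, s ≤ m → stp m p (FF m i j s) c = FF m i' j' s := by
  by_cases hc : c = p
  · by_cases h : i < m
    · refine ⟨i, if j = m then m else j + 1, hi, by split_ifs <;> omega, fun s hs => ?_⟩
      simp only [stp, FF, hc, h, if_true]; split_ifs <;> omega
    · by_cases h0 : j = 0
      · refine ⟨i, j, hi, hj, fun s hs => ?_⟩
        simp [stp, FF, h, h0]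
      · refine ⟨i, if j = m then m else j + 1, hi, by split_ifs <;> omega, fun s hs => ?_⟩
        simp only [stp, FF, hc, h, h0, if_true, if_false]; split_ifs <;> first | omega | simp_all | (simp_all; omega)
  · by_cases h : i < m
    · by_cases hjm : j = m
      · refine ⟨m, 0, le_rfl, by omega, fun s hs => ?_⟩
        simp only [stp, FF, hc, h, if_true, if_false]; split_ifs <;> omega
      · refine ⟨i, 0, hi, by omega, fun s hs => ?_⟩
        simp only [stp, FF, hc, h, if_true, if_false]; split_ifs <;> omega
    · by_cases h0 : j = 0
      · refine ⟨i, j, hi, hj, fun s hs => ?_⟩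
        simp [stp, FF, h, h0]
      · by_cases hjm : j = m
        · refine ⟨m, 0, le_rfl, by omega, fun s hs => ?_⟩
          simp only [stp, FF, hc, h, h0, if_false]; split_ifs <;> omega
        · refine ⟨j, 0, hj, by omega, fun s hs => ?_⟩
          simp only [stp, FF, hc, h, h0, if_false]; split_ifs <;> omega

theorem FF_surj (m : ℕ) (hm : 1 ≤ m) (p : Letter) (u : List Letter) (hu : u ≠ []) :
    ∃ i j, i ≤ m ∧ j ≤ m ∧ ∀ s, s ≤ m → rn m p s u = FF m i j s := by
  induction u using List.reverseRecOn with
  | nil => exact absurd rfl hu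
  | append_singleton u c ih =>
    by_cases h : u = []
    · subst h
      by_cases hc : c = p
      · refine ⟨m, 1, le_rfl, hm, fun s hs => ?_⟩
        simp only [rn, List.nil_append, List.foldl_cons, List.foldl_nil, stp, FF, hc, if_true]
        split_ifs <;> first | omega | simp_all | (simp_all; omega)
      · refine ⟨0, 0, by omega, by omega, fun s hs => ?_⟩
        simp only [rn, List.nil_append, List.foldl_cons, List.foldl_nil, stp, FF, hc, if_false]
        split_ifs <;> omega
    · obtain ⟨i, j, hi, hj, e⟩ := ih h
      obtain ⟨i', j', hi', hj', e'⟩ := FF_step m hm p c i j hi hj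
      refine ⟨i', j', hi', hj', fun s hs => ?_⟩
      rw [rn_append, e s hs, ← e' s hs]; rfl

theorem FF_inj (m i j i' j' : ℕ) (hi : i ≤ m) (hj : j ≤ m) (hi' : i' ≤ m)
    (hj' : j' ≤ m) (h : ∀ s, s ≤ m → FF m i j s = FF m i' j' s) : i = i' ∧ j = j' := by
  have h0 := h 0 (by omega)
  have h1 := h m le_rfl
  have h2 := h (m - i) (by omega)
  have h3 := h (m - i') (by omega)
  unfold FF at h0 h1 h2 h3
  by_cases a : i < m <;> by_cases b : i' < m <;> simp only [a, b, if_true, if_false] at h0 h1 h2 h3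
  · split_ifs at h0 h2 h3 <;> omega
  · split_ifs at h0 h1 <;> omega
  · split_ifs at h0 h1 <;> omega
  · split_ifs at h0 <;> omega

theorem rp_ne (m : ℕ) (p q : Letter) (i j : ℕ) : rp m p q i j ≠ [] := by
  unfold rp; split_ifs <;> simp_all

theorem main_case (m : ℕ) (hm : 1 ≤ m) (p q : Letter) (hpq : q ≠ p)
    (hc : ∀ c, c ≠ p → c = q) :
    syntacticComplexity (factorLang (List.replicate m p ++ [q])) = (m + 1) ^ 2 := by
  unfold syntacticComplexity
  let f : Fin (m+1) × Fin (m+1) → Quotient (synSetoid (factorLang (List.replicate m p ++ [q]))) :=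
    fun x => Quotient.mk _ ⟨rp m p q x.1 x.2, rp_ne _ _ _ _ _⟩
  have hf : Function.Bijective f := by
    constructor
    · rintro ⟨⟨i, hi⟩, ⟨j, hj⟩⟩ ⟨⟨i', hi'⟩, ⟨j', hj'⟩⟩ h
      have h := (equiv_iff m p q hpq hc _ _).1 (Quotient.exact h)
      have := FF_inj m i j i' j' (by omega) (by omega) (by omega) (by omega) (fun s hs => by
        have := h s hs
        rwa [rn_rp m p q hpq i j s (by omega) hs, rn_rp m p q hpq i' j' s (by omega) hs] at this)
      simp [this.1, this.2]
    · intro y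
      induction y using Quotient.inductionOn with
      | h u =>
        obtain ⟨i, j, hi, hj, e⟩ := FF_surj m hm p u.1 u.2
        refine ⟨(⟨i, by omega⟩, ⟨j, by omega⟩), Quotient.sound ?_⟩
        refine (equiv_iff m p q hpq hc _ _).2 fun s hs => ?_
        rw [e s hs]; exact rn_rp m p q hpq i j s hj hs
  rw [← Nat.card_congr (Equiv.ofBijective f hf)]
  simp [sq]

theorem rev_case (w : List Letter) :
    syntacticComplexity (factorLang w.reverse) = syntacticComplexity (factorLang w) := by
  have hmem : ∀ u : List Letter, u ∈ factorLang w.reverse ↔ u.reverse ∈ factorLang w := by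
    intro u
    have := List.reverse_infix (l₁ := w) (l₂ := u.reverse)
    simpa [factorLang] using this
  unfold syntacticComplexity
  let e : {u : List Letter // u ≠ []} ≃ {u : List Letter // u ≠ []} :=
    { toFun := fun u => ⟨u.1.reverse, by simpa using u.2⟩
      invFun := fun u => ⟨u.1.reverse, by simpa using u.2⟩
      left_inv := fun u => by simp
      right_inv := fun u => by simp }
  refine Nat.card_congr (Quotient.congr e ?_)
  intro u v
  constructor
  · intro h x y
    have := h y.reverse x.reverse
    rw [hmem, hmem] at this
    simpa [e] using this
  · intro h x y
    have := h y.reverse x.reverse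
    rw [hmem, hmem]
    simpa [e] using this

/-- For n ≥ 2 and w ∈ {a^{n-1}b, ab^{n-1}, ba^{n-1}, b^{n-1}a}, the syntactic
complexity of L = Σ* w Σ* equals n². -/
theorem stmt13 (n : ℕ) (hn : 2 ≤ n) (w : List Letter)
    (hw : w = List.replicate (n - 1) Letter.a ++ [Letter.b] ∨
          w = Letter.a :: List.replicate (n - 1) Letter.b ∨
          w = Letter.b :: List.replicate (n - 1) Letter.a ∨
          w = List.replicate (n - 1) Letter.b ++ [Letter.a]) :
    syntacticComplexity (factorLang w) = n ^ 2 := by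
  obtain ⟨m, rfl⟩ : ∃ m, n = m + 1 := ⟨n - 1, by omega⟩
  have hm : 1 ≤ m := by omega
  have hA := main_case m hm Letter.a Letter.b (by simp) (by intro c; cases c <;> simp)
  have hB := main_case m hm Letter.b Letter.a (by simp) (by intro c; cases c <;> simp)
  simp only [Nat.add_sub_cancel] at hw
  rcases hw with rfl | rfl | rfl | rfl
  · exact hA
  · rw [← hB, ← rev_case]; simp
  · rw [← hA, ← rev_case]; simp
  · exact hB
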